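/- arXiv:1701.06320 — 3 statements merged into one kernel-verified Lean document; each statement's English description precedes it below -/
import Mathlib

section
/- Let T̃_g ∈ S(X,ℝ,C^α_P), let u : X ∖ R_P → ℝ be the unique uniformly bounded invariant graph on X ∖ R_P, and suppose P consists of ρ periodic orbits P_0,…,P_{ρ-1}. For each 0 ≤ r ≤ ρ−1 choose one element p_r of the orbit P_r. Then there is a ρ-parameter family of invariant graphs u_s : X → ℝ of the skew product, indexed by s = (s_0,…,s_{ρ-1}) ∈ ℝ^ρ, with u_s(p_r) = s_r for each r, with u_s uniformly bounded (with bound depending only on s and u), and with u_s restricted to X ∖ R_P equal to u. -/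
open Filter Set Metric Topology MeasureTheory

noncomputable section

namespace Bony

/-- A continuous (piecewise `C¹`) expanding Markov map of the circle `X`:
`X` is homeomorphic to the circle, is covered by finitely many closed pieces with
pairwise disjoint interiors, `T` is continuous, expands distances by at least `θ⁻¹ > 1`
on each piece, maps each piece onto a union of pieces, is locally eventually onto, and
has a (piecewise-continuous) absolute derivative `dT` bounded below by `θ⁻¹`. -/
structure ExpandingMarkov (X : Type*) [MetricSpace X] [CompactSpace X] where
  circle : Nonempty (X ≃ₜ AddCircle (1 : ℝ))
  T : X → X
  contT : Continuous T
  θ : ℝ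
  θ_pos : 0 < θ
  θ_lt_one : θ < 1
  b : ℕ
  b_pos : 0 < b
  piece : Fin b → Set X
  piece_closed : ∀ j, IsClosed (piece j)
  piece_nonempty : ∀ j, (piece j).Nonempty
  piece_cover : ⋃ j, piece j = Set.univ
  piece_int_disj : ∀ i j, i ≠ j → interior (piece i) ∩ interior (piece j) = ∅
  expand : ∀ j, ∀ x ∈ piece j, ∀ y ∈ piece j, dist x y ≤ θ * dist (T x) (T y)
  markov : ∀ j, ∃ I : Set (Fin b), T '' piece j = ⋃ i ∈ I, piece i
  leo : ∃ N : ℕ, ∀ j, T^[N] '' piece j = Set.univ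
  dT : X → ℝ
  dT_lb : ∀ x, θ⁻¹ ≤ dT x
  dT_contOn : ∀ j, ContinuousOn dT (interior (piece j))
  dT_deriv : ∀ j, ∀ x ∈ interior (piece j), ∀ ε > (0:ℝ), ∃ δ > (0:ℝ),
    ∀ y ∈ piece j, dist x y < δ → |dist (T x) (T y) - dT x * dist x y| ≤ ε * dist x y

variable {X : Type*} [MetricSpace X] [CompactSpace X]

/-- `m` is the least period of `p` under `T`. -/
def IsLeastPeriod (T : X → X) (p : X) (m : ℕ) : Prop :=
  0 < m ∧ T^[m] p = p ∧ ∀ m', 0 < m' → T^[m'] p = p → m ≤ m'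

/-- The set `R_P` of all pre-images of the finite set `P`. -/
def RP (M : ExpandingMarkov X) (P : Finset X) : Set X := {x | ∃ n : ℕ, M.T^[n] x ∈ P}

/-- `g^n_x = g_{T^{n-1}x} ∘ ⋯ ∘ g_x`. -/
def gIter (T : X → X) (g : X → ℝ → ℝ) : ℕ → X → ℝ → ℝ
  | 0, _, t => t
  | n + 1, x, t => g (T^[n] x) (gIter T g n x t)

/-- `h^n_x = h_x ∘ ⋯ ∘ h_{T^{n-1}x}`, the inverse of `g^n_x`. -/
def hIter (T : X → X) (h : X → ℝ → ℝ) : ℕ → X → ℝ → ℝ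
  | 0, _, t => t
  | n + 1, x, t => h x (hIter T h n (T x) t)

open Classical in
/-- The number of visits of the orbit segment `x, Tx, …, T^{n-1}x` to `X ∖ B_δ(P)`. -/
def visits (M : ExpandingMarkov X) (P : Finset X) (δ : ℝ) (n : ℕ) (x : X) : ℕ :=
  ((Finset.range n).filter fun j => δ ≤ infDist (M.T^[j] x) (P : Set X)).card

/-- Membership in the class `S(X,ℝ,C^α_P)` of skewing functions, with fixed constant
`C_S` and Hölder exponent `α`: `g x` is a homeomorphism of `ℝ` with inverse `h x`;
`g^{ℓ(p)}_p = id` on the periodic orbits of `P`; the fibre maps `h^n_x` are uniformly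
`C_S`-Lipschitz; a slow-contraction lower bound holds near `P` (with `log λ` `α`-Hölder,
`λ(0) = 1`); contraction by `λ_δ` per visit to `X ∖ B_δ(P)`; `x ↦ g_x(t)` and
`x ↦ h_x(t)` are `α`-Hölder; and a uniform exponential lower bound `λ_min^n` holds. -/
def InClass (M : ExpandingMarkov X) (P : Finset X) (CS α : ℝ) (g h : X → ℝ → ℝ) : Prop :=
  (∀ x, Continuous (g x)) ∧ (∀ x, Continuous (h x)) ∧
  (∀ x t, g x (h x t) = t) ∧ (∀ x t, h x (g x t) = t) ∧
  (∀ p ∈ P, ∃ ℓ, IsLeastPeriod M.T p ℓ ∧ ∀ t, gIter M.T g ℓ p t = t) ∧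
  (∀ (n : ℕ) (x : X) (t t' : ℝ), |hIter M.T h n x t - hIter M.T h n x t'| ≤ CS * |t - t'|) ∧
  (∃ ε > (0:ℝ), ∃ lam : ℝ → ℝ,
    (∀ s ∈ Icc (0:ℝ) ε, 0 < lam s) ∧ lam 0 = 1 ∧
    (∃ C : ℝ, 0 ≤ C ∧ ∀ s ∈ Icc (0:ℝ) ε, ∀ s' ∈ Icc (0:ℝ) ε,
      |Real.log (lam s) - Real.log (lam s')| ≤ C * |s - s'| ^ α) ∧
    (∀ (n : ℕ) (x : X), (∀ j < n, infDist (M.T^[j] x) (P : Set X) < ε) →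
      ∀ t t' : ℝ, CS⁻¹ * (∏ j ∈ Finset.range n, lam (infDist (M.T^[j] x) (P : Set X))) * |t - t'|
        ≤ |hIter M.T h n x t - hIter M.T h n x t'|) ∧
    (∀ δ : ℝ, 0 < δ → δ ≤ ε → ∃ lamδ : ℝ, 0 < lamδ ∧ lamδ < 1 ∧
      ∀ (n : ℕ) (x : X) (t t' : ℝ),
        |hIter M.T h n x t - hIter M.T h n x t'| ≤ CS * lamδ ^ visits M P δ n x * |t - t'|)) ∧
  (∃ Cg : ℝ → ℝ, (∀ t, 0 ≤ Cg t) ∧ (∀ (t : ℝ) (x y : X), |g x t - g y t| ≤ Cg t * dist x y ^ α) ∧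
    ∀ K : Set ℝ, IsCompact K → BddAbove (Cg '' K)) ∧
  (∃ Ch : ℝ → ℝ, (∀ t, 0 ≤ Ch t) ∧ (∀ (t : ℝ) (x y : X), |h x t - h y t| ≤ Ch t * dist x y ^ α) ∧
    ∀ K : Set ℝ, IsCompact K → BddAbove (Ch '' K)) ∧
  (∃ lmin : ℝ, 0 < lmin ∧ ∀ (n : ℕ) (x : X) (t t' : ℝ),
    CS⁻¹ * lmin ^ n * |t - t'| ≤ |hIter M.T h n x t - hIter M.T h n x t'|)

/-- A skew product `T̃_g(x,t) = (Tx, g_x(t))` in the class `S(X,ℝ,C^α_P)`. -/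
structure Skew (M : ExpandingMarkov X) (P : Finset X) where
  CS : ℝ
  CS_ge_one : 1 ≤ CS
  α : ℝ
  α_pos : 0 < α
  g : X → ℝ → ℝ
  h : X → ℝ → ℝ
  mem : InClass M P CS α g h
  Pinv : ∀ p ∈ P, M.T p ∈ P

/-- `u` is an invariant graph on `S`: `u(Tx) = g_x(u(x))` for `x ∈ S`. -/
def InvariantOn (T : X → X) (g : X → ℝ → ℝ) (u : X → ℝ) (S : Set X) : Prop :=
  ∀ x ∈ S, u (T x) = g x (u x)

/-- `u` is uniformly bounded on `S`. -/
def BoundedOn (u : X → ℝ) (S : Set X) : Prop := ∃ B : ℝ, ∀ x ∈ S, |u x| ≤ B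

/-- `limsup_{y → x, y ∈ S} u(y)`. -/
def upperU (u : X → ℝ) (S : Set X) (x : X) : ℝ := limsup u (𝓝[S] x)

/-- `liminf_{y → x, y ∈ S} u(y)`. -/
def lowerU (u : X → ℝ) (S : Set X) (x : X) : ℝ := liminf u (𝓝[S] x)

open Classical in
/-- The fibre of the invariant quasi-graph over `x`. -/
def UFib (M : ExpandingMarkov X) (P : Finset X) (u : X → ℝ) (x : X) : Set ℝ :=
  if x ∈ RP M P then Icc (lowerU u (RP M P)ᶜ x) (upperU u (RP M P)ᶜ x) else {u x}

open Classical in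
/-- The length `|U_x|` of the fibre of the quasi-graph over `x`. -/
def Ulen (M : ExpandingMarkov X) (P : Finset X) (u : X → ℝ) (x : X) : ℝ :=
  if x ∈ RP M P then upperU u (RP M P)ᶜ x - lowerU u (RP M P)ᶜ x else 0

/-- The invariant quasi-graph `U ⊆ X × ℝ`. -/
def quasiGraph (M : ExpandingMarkov X) (P : Finset X) (u : X → ℝ) : Set (X × ℝ) :=
  {q | q.2 ∈ UFib M P u q.1}

/-- The quasi-graph of every bounded invariant graph of `T̃_g` is not the graph of
a function: it has a jump at every point of `R_P`. -/
def NotGraph (M : ExpandingMarkov X) (P : Finset X) (g : X → ℝ → ℝ) : Prop :=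
  ∀ u : X → ℝ, BoundedOn u (RP M P)ᶜ → InvariantOn M.T g u (RP M P)ᶜ →
    ∀ x ∈ RP M P, 0 < Ulen M P u x

/-- `C⁰`-closeness (uniform distance at most `ε`) of skewing functions. -/
def C0Close (g g' : X → ℝ → ℝ) (ε : ℝ) : Prop := ∀ (x : X) (t : ℝ), |g x t - g' x t| ≤ ε

/-- `C^α`-closeness of skewing functions: the difference is uniformly small and has a
small `α`-Hölder seminorm (in the base variable), uniformly in the fibre variable. -/
def HolderClose (α : ℝ) (g g' : X → ℝ → ℝ) (ε : ℝ) : Prop :=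
  (∀ (x : X) (t : ℝ), |g x t - g' x t| ≤ ε) ∧
  ∀ (t : ℝ) (x y : X), |(g x t - g' x t) - (g y t - g' y t)| ≤ ε * dist x y ^ α

/-- `C` is a cylinder of rank `n` for the Markov map `M`. -/
def IsCylinder (M : ExpandingMarkov X) (n : ℕ) (C : Set X) : Prop :=
  C.Nonempty ∧ ∃ w : Fin n → Fin M.b, C = {x | ∀ i : Fin n, M.T^[(i : ℕ)] x ∈ M.piece (w i)}

/-- The set of fibre values of the quasi-graph over the set `C`. -/
def UOver (M : ExpandingMarkov X) (P : Finset X) (u : X → ℝ) (C : Set X) : Set ℝ :=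
  {t | ∃ x ∈ C, t ∈ UFib M P u x}

/-- The smallest interval `U_{C}` such that `C × U_C` contains the quasi-graph over `C`. -/
def UInt (M : ExpandingMarkov X) (P : Finset X) (u : X → ℝ) (C : Set X) : Set ℝ :=
  Icc (sInf (UOver M P u C)) (sSup (UOver M P u C))

/-- The height of the quasi-graph over the set `C`. -/
def Height (M : ExpandingMarkov X) (P : Finset X) (u : X → ℝ) (C : Set X) : ℝ :=
  sSup (UOver M P u C) - sInf (UOver M P u C)

/-- The product `∏_{j=0}^{n-1} ∂h_{T^j x}(g^{j+1}_x(s))`. -/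
def prodDh (M : ExpandingMarkov X) (dh : X → ℝ → ℝ) (g : X → ℝ → ℝ)
    (n : ℕ) (x : X) (s : ℝ) : ℝ :=
  ∏ j ∈ Finset.range n, dh (M.T^[j] x) (gIter M.T g (j + 1) x s)

/-- The extra data and conditions making a skew product a member of the class
`S(X,ℝ,C^{Lip,2}_P)`: each fibre map `h_x` is `C²` with positive derivative `∂h_x = dh x`
and second derivative `d2h x`, and `x ↦ h_x(t)`, `x ↦ ∂h_x(t)`, `x ↦ ∂²h_x(t)` are
Lipschitz continuous (with constants bounded on compact sets of `t`). -/
structure Lip2Data (M : ExpandingMarkov X) (P : Finset X) (Sk : Skew M P) where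
  dh : X → ℝ → ℝ
  d2h : X → ℝ → ℝ
  dh_pos : ∀ x t, 0 < dh x t
  h_deriv : ∀ x t, HasDerivAt (Sk.h x) (dh x t) t
  dh_deriv : ∀ x t, HasDerivAt (dh x) (d2h x t) t
  h_lipx : ∃ L : ℝ → ℝ, (∀ t, 0 ≤ L t) ∧ (∀ (t : ℝ) (x y : X), |Sk.h x t - Sk.h y t| ≤ L t * dist x y) ∧
    ∀ K : Set ℝ, IsCompact K → BddAbove (L '' K)
  dh_lipx : ∃ L : ℝ → ℝ, (∀ t, 0 ≤ L t) ∧ (∀ (t : ℝ) (x y : X), |dh x t - dh y t| ≤ L t * dist x y) ∧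
    ∀ K : Set ℝ, IsCompact K → BddAbove (L '' K)
  d2h_lipx : ∃ L : ℝ → ℝ, (∀ t, 0 ≤ L t) ∧ (∀ (t : ℝ) (x y : X), |d2h x t - d2h y t| ≤ L t * dist x y) ∧
    ∀ K : Set ℝ, IsCompact K → BddAbove (L '' K)

/-- Partial hyperbolicity: `κ ≤ inf ∂h ⋅ inf |T'|` for some `κ > 1`. -/
def PartHyp (M : ExpandingMarkov X) {P : Finset X} {Sk : Skew M P} (L : Lip2Data M P Sk) : Prop :=
  ∃ κ : ℝ, 1 < κ ∧ ∀ (x y : X) (t : ℝ), κ ≤ L.dh x t * M.dT y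

open Classical in
/-- The function `𝒟h`. -/
def Dh (M : ExpandingMarkov X) (P : Finset X) (dh : X → ℝ → ℝ) (u : X → ℝ) (x : X) : ℝ :=
  if x ∈ RP M P then dh x (upperU u (RP M P)ᶜ (M.T x)) else dh x (u (M.T x))

/-- The Birkhoff sum `φ^n(x) = ∑_{j<n} φ(T^j x)`. -/
def birk (T : X → X) (φ : X → ℝ) (n : ℕ) (x : X) : ℝ := ∑ j ∈ Finset.range n, φ (T^[j] x)

/-- The partition function `Z(φ,n)`: infimum over finite covers of `X` by cylinders of
rank at least `n` of `∑ exp sup_{C} φ^ℓ`. -/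
def Zfun (M : ExpandingMarkov X) (φ : X → ℝ) (n : ℕ) : ℝ :=
  sInf {z : ℝ | ∃ s : Finset (ℕ × Set X),
    (∀ p ∈ s, n ≤ p.1 ∧ IsCylinder M p.1 p.2) ∧ (Set.univ ⊆ ⋃ p ∈ s, p.2) ∧
    z = ∑ p ∈ s, Real.exp (sSup (birk M.T φ p.1 '' p.2))}

/-- The topological pressure of `φ` is `c`. -/
def HasPressure (M : ExpandingMarkov X) (φ : X → ℝ) (c : ℝ) : Prop :=
  Tendsto (fun n : ℕ => Real.log (Zfun M φ n) / n) atTop (𝓝 c)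

/-- The least number of balls of diameter `r` needed to cover `U ⊆ X × ℝ`. -/
def Ncov (U : Set (X × ℝ)) (r : ℝ) : ℕ :=
  sInf {k : ℕ | ∃ s : Finset (X × ℝ), s.card = k ∧ U ⊆ ⋃ c ∈ s, Metric.ball c (r / 2)}

/-- The box dimension of `U ⊆ X × ℝ` exists and equals `d`. -/
def HasBoxDim (U : Set (X × ℝ)) (d : ℝ) : Prop :=
  Tendsto (fun r : ℝ => Real.log (Ncov U r) / (-Real.log r)) (𝓝[>] (0:ℝ)) (𝓝 d)

lemma ExpandingMarkov.finite_preimage (M : ExpandingMarkov X) {F : Set X} (hF : F.Finite) :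
    (M.T ⁻¹' F).Finite := by
  have hsub : M.T ⁻¹' F ⊆ ⋃ j, (M.piece j ∩ M.T ⁻¹' F) := by
    intro x hx
    obtain ⟨j, hj⟩ := mem_iUnion.1 (M.piece_cover ▸ mem_univ x)
    exact mem_iUnion.2 ⟨j, hj, hx⟩
  refine (finite_iUnion fun j => ?_).subset hsub
  refine Finite.of_finite_image (f := M.T) (hF.subset ?_) ?_
  · rintro _ ⟨x, hx, rfl⟩
    exact hx.2
  · intro x hx y hy hxy
    have h := M.expand j x hx.1 y hy.1
    rw [hxy, dist_self, mul_zero] at h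
    exact dist_le_zero.1 h

lemma ExpandingMarkov.finite_iterate_preimage (M : ExpandingMarkov X) {F : Set X}
    (hF : F.Finite) (n : ℕ) : (M.T^[n] ⁻¹' F).Finite := by
  induction n with
  | zero => exact hF
  | succ n ih =>
    rw [Function.iterate_succ, preimage_comp]
    exact M.finite_preimage ih

lemma ExpandingMarkov.dense_compl_RP (M : ExpandingMarkov X) (P : Finset X) :
    Dense (RP M P)ᶜ := by
  obtain ⟨e⟩ := M.circle
  have hconn : ConnectedSpace X := e.connectedSpace_iff.2 inferInstance
  have : Fact ((0 : ℝ) < 1) := ⟨one_pos⟩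
  have hIco : (Ico (0 : ℝ) (0 + 1)).Nontrivial :=
    ⟨0, by norm_num, 1 / 2, by norm_num, by norm_num⟩
  have : Nontrivial (Ico (0 : ℝ) (0 + 1)) := hIco.coe_sort
  have : Nontrivial (AddCircle (1 : ℝ)) := (AddCircle.equivIco 1 0).nontrivial
  have : Nontrivial X := e.toEquiv.nontrivial
  have heq : (RP M P)ᶜ = ⋂ n : ℕ, (M.T^[n] ⁻¹' (P : Set X))ᶜ := by
    ext x
    simp [RP]
  rw [heq]
  refine dense_iInter_of_isOpen_nat (fun n => ?_) fun n => ?_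
  · exact (M.finite_iterate_preimage P.finite_toSet n).isClosed.isOpen_compl
  · rw [compl_eq_univ_sdiff]
    exact dense_univ.sdiff_finite (M.finite_iterate_preimage P.finite_toSet n)

/-- The skew product `(x, t) ↦ (T x, g x t)`. -/
def skewMap {Y : Type*} (T : Y → Y) (g : Y → ℝ → ℝ) (z : Y × ℝ) : Y × ℝ := (T z.1, g z.1 z.2)

lemma skewMap_iterate {Y : Type*} (T : Y → Y) (g : Y → ℝ → ℝ) (n : ℕ) (x : Y) (t : ℝ) :
    (skewMap T g)^[n] (x, t) = (T^[n] x, gIter T g n x t) := by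
  induction n with
  | zero => rfl
  | succ n ih =>
    rw [Function.iterate_succ_apply', ih, Function.iterate_succ_apply']
    rfl

lemma skewMap_iterate_eq_iff {Y : Type*} {T : Y → Y} {g h : Y → ℝ → ℝ}
    (hgh : ∀ x t, g x (h x t) = t) (hhg : ∀ x t, h x (g x t) = t) (n : ℕ) (x y : Y) (t t' : ℝ) :
    (skewMap T g)^[n] (x, t) = (y, t') ↔ T^[n] x = y ∧ t = hIter T h n x t' := by
  induction n generalizing x t with
  | zero => simp [hIter]
  | succ n ih =>
    rw [Function.iterate_succ_apply, Function.iterate_succ_apply, skewMap, ih]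
    refine and_congr_right fun _ => ⟨fun H => ?_, fun H => ?_⟩
    · change t = h x (hIter T h n (T x) t')
      rw [← H, hhg]
    · change g x t = _
      rw [H, hIter, hgh]

/-- Closing up under the base map closes up in the fibre too, when the base period does. -/
lemma IsLeastPeriod.skewMap_iterate_eq {Y : Type*} {T : Y → Y} {g : Y → ℝ → ℝ} {p : Y} {ℓ d : ℕ}
    {t : ℝ} (hℓ : IsLeastPeriod T p ℓ) (hg : gIter T g ℓ p t = t) (hd : T^[d] p = p) :
    (skewMap T g)^[d] (p, t) = (p, t) := by
  have hmin : Function.minimalPeriod T p = ℓ :=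
    le_antisymm (Function.IsPeriodicPt.minimalPeriod_le hℓ.1 hℓ.2.1)
      (hℓ.2.2 _ (Function.IsPeriodicPt.minimalPeriod_pos hℓ.1 hℓ.2.1)
        (Function.iterate_minimalPeriod))
  have hdvd : ℓ ∣ d := hmin ▸ Function.IsPeriodicPt.minimalPeriod_dvd hd
  have hper : Function.IsPeriodicPt (skewMap T g) ℓ (p, t) := by
    rw [Function.IsPeriodicPt, Function.IsFixedPt, skewMap_iterate, hℓ.2.1, hg]
  exact hper.trans_dvd hdvd

section Skew

variable {M : ExpandingMarkov X} {P : Finset X}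

lemma Skew.continuous_h (Sk : Skew M P) : Continuous fun z : X × ℝ => Sk.h z.1 z.2 := by
  obtain ⟨-, -, -, -, -, hlip, -, -, ⟨Ch, -, hCh, -⟩, -⟩ := Sk.mem
  have hCS : 0 ≤ Sk.CS := zero_le_one.trans Sk.CS_ge_one
  refine continuous_prod_of_continuous_lipschitzWith' _ ⟨Sk.CS, hCS⟩ (fun x => ?_) fun t => ?_
  · exact LipschitzWith.of_dist_le_mul fun t t' => hlip 1 x t t'
  · refine continuous_iff_continuousAt.2 fun y => tendsto_iff_dist_tendsto_zero.2 ?_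
    refine squeeze_zero (fun _ => dist_nonneg) (fun x => hCh t x y) ?_
    have hc : Continuous fun x : X => Ch t * dist x y ^ Sk.α :=
      continuous_const.mul ((continuous_id.dist continuous_const).rpow_const
        fun _ => Or.inr Sk.α_pos.le)
    simpa [Real.zero_rpow Sk.α_pos.ne'] using hc.tendsto y

lemma Skew.continuous_hIter (Sk : Skew M P) (n : ℕ) (t : ℝ) :
    Continuous fun x => hIter M.T Sk.h n x t := by
  induction n with
  | zero => exact continuous_const
  | succ n ih => exact Sk.continuous_h.comp (continuous_id.prodMk (ih.comp M.contT))

lemma mem_RP_of_map_mem {x : X} (hx : M.T x ∈ RP M P) : x ∈ RP M P :=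
  let ⟨n, hn⟩ := hx
  ⟨n + 1, hn⟩

/-- The inverse fibre maps pull back bounded values to bounded values along the invariant graph `u`;
the bound extends to all base points by density of the complement of `RP M P`. -/
lemma Skew.abs_hIter_le (Sk : Skew M P) {u : X → ℝ} {B : ℝ}
    (hub : ∀ x ∈ (RP M P)ᶜ, |u x| ≤ B) (hui : InvariantOn M.T Sk.g u (RP M P)ᶜ)
    (n : ℕ) (x : X) (t : ℝ) : |hIter M.T Sk.h n x t| ≤ Sk.CS * (|t| + B) + B := by
  obtain ⟨-, -, hgh, hhg, -, hlip, -⟩ := Sk.mem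
  have hCS : 0 ≤ Sk.CS := zero_le_one.trans Sk.CS_ge_one
  have hclosed : IsClosed {y | |hIter M.T Sk.h n y t| ≤ Sk.CS * (|t| + B) + B} :=
    isClosed_le (Sk.continuous_hIter n t).abs continuous_const
  refine closure_minimal (fun y hy => ?_) hclosed
    ((M.dense_compl_RP P).closure_eq ▸ mem_univ x)
  have horbit : ∀ m, M.T^[m] y ∈ (RP M P)ᶜ ∧
      (skewMap M.T Sk.g)^[m] (y, u y) = (M.T^[m] y, u (M.T^[m] y)) := by
    intro m
    induction m with
    | zero => exact ⟨hy, rfl⟩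
    | succ m ih =>
      rw [Function.iterate_succ_apply', Function.iterate_succ_apply', ih.2, hui _ ih.1]
      exact ⟨fun h => ih.1 (mem_RP_of_map_mem h), rfl⟩
  have hu := ((skewMap_iterate_eq_iff hgh hhg n _ _ _ _).1 (horbit n).2).2
  have h1 := hlip n y t (u (M.T^[n] y))
  rw [← hu] at h1
  have h2 : |t - u (M.T^[n] y)| ≤ |t| + B :=
    (abs_sub _ _).trans (by gcongr; exact hub _ (horbit n).1)
  have h3 := abs_sub_abs_le_abs_sub (hIter M.T Sk.h n y t) (u y)
  have h4 := mul_le_mul_of_nonneg_left h2 hCS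
  have h5 := hub y hy
  change |hIter M.T Sk.h n y t| ≤ _
  linarith

end Skew

/-- **Corollary (a `ρ`-parameter family of invariant graphs).**
If `u` is the unique uniformly bounded invariant graph on `X ∖ R_P` and `P` consists of
`ρ` distinct periodic orbits with chosen representatives `p 0, …, p (ρ-1)`, then for each
`s ∈ ℝ^ρ` there is an invariant graph `u_s : X → ℝ` of the skew product with
`u_s (p r) = s r`, uniformly bounded, and agreeing with `u` on `X ∖ R_P`. -/
theorem rho_parameter_family_of_invariant_graphs
    (M : ExpandingMarkov X) (P : Finset X) (Sk : Skew M P)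
    (u : X → ℝ) (hub : BoundedOn u (RP M P)ᶜ) (hui : InvariantOn M.T Sk.g u (RP M P)ᶜ)
    (ρ : ℕ) (p : Fin ρ → X) (hp : ∀ r, p r ∈ P)
    (horb : ∀ q ∈ P, ∃! r : Fin ρ, ∃ n : ℕ, M.T^[n] (p r) = q) :
    ∀ s : Fin ρ → ℝ, ∃ us : X → ℝ,
      (∀ x, us (M.T x) = Sk.g x (us x)) ∧
      (∀ r, us (p r) = s r) ∧
      (∃ B : ℝ, ∀ x, |us x| ≤ B) ∧
      ∀ x ∈ (RP M P)ᶜ, us x = u x := by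
  intro s
  classical
  obtain ⟨B, hB⟩ := hub
  obtain ⟨-, -, hgh, hhg, hper, -⟩ := Sk.mem
  set F := skewMap M.T Sk.g with hF
  have hclose : ∀ r d, M.T^[d] (p r) = p r → F^[d] (p r, s r) = (p r, s r) := by
    intro r d hd
    obtain ⟨ℓ, hℓ, hg⟩ := hper _ (hp r)
    exact hℓ.skewMap_iterate_eq (hg _) hd
  let V : X → ℝ → Prop := fun x t => ∃ n r, F^[n] (x, t) = (p r, s r)
  have hV : ∀ {x t}, V x t → ∃ n r, M.T^[n] x = p r ∧ t = hIter M.T Sk.h n x (s r) :=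
    fun ⟨n, r, h⟩ => ⟨n, r, (skewMap_iterate_eq_iff hgh hhg n _ _ _ _).1 h⟩
  have hstep : ∀ {x t}, V x t → V (M.T x) (Sk.g x t) := by
    rintro x t ⟨n, r, h⟩
    obtain ⟨ℓ, hℓ, -⟩ := hper _ (hp r)
    have h' : F^[ℓ + n] (x, t) = (p r, s r) := by
      rw [Function.iterate_add_apply, h, hclose r ℓ hℓ.2.1]
    obtain ⟨k, hk⟩ := Nat.exists_eq_succ_of_ne_zero (by have := hℓ.1; omega : ℓ + n ≠ 0)
    rw [hk, Function.iterate_succ_apply] at h'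
    exact ⟨k, r, h'⟩
  have huniq : ∀ {x t t'}, V x t → V x t' → t = t' := by
    have key : ∀ {x t t' n n' r r'}, n ≤ n' → F^[n] (x, t) = (p r, s r) →
        F^[n'] (x, t') = (p r', s r') → t = t' := by
      intro x t t' n n' r r' hnn h h'
      obtain ⟨d, rfl⟩ := Nat.exists_eq_add_of_le' hnn
      have hb := ((skewMap_iterate_eq_iff hgh hhg _ _ _ _ _).1 h).1
      have hb' := (skewMap_iterate_eq_iff hgh hhg _ _ _ _ _).1 h'
      have hd : M.T^[d] (p r) = p r' := by
        rw [← hb, ← Function.iterate_add_apply, hb'.1]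
      obtain rfl : r = r' := (horb _ (hp r')).unique ⟨d, hd⟩ ⟨0, rfl⟩
      have h2 : F^[d + n] (x, t) = (p r, s r) := by
        rw [Function.iterate_add_apply, h, hclose r d hd]
      exact ((skewMap_iterate_eq_iff hgh hhg _ _ _ _ _).1 h2).2.trans hb'.2.symm
    rintro x t t' ⟨n, r, h⟩ ⟨n', r', h'⟩
    rcases le_total n n' with hnn | hnn
    · exact key hnn h h'
    · exact (key hnn h' h).symm
  have hex : ∀ x ∈ RP M P, ∃ t, V x t := by
    rintro x ⟨n, hn⟩
    obtain ⟨r, ⟨k, hk⟩, -⟩ := horb _ hn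
    obtain ⟨ℓ, hℓ, -⟩ := hper _ (hp r)
    have hkl : k ≤ k * ℓ := Nat.le_mul_of_pos_right k hℓ.1
    have hbase : M.T^[(k * ℓ - k) + n] x = p r := by
      rw [Function.iterate_add_apply, ← hk, ← Function.iterate_add_apply, Nat.sub_add_cancel hkl]
      exact Function.IsPeriodicPt.const_mul hℓ.2.1 k
    exact ⟨_, _, r, (skewMap_iterate_eq_iff hgh hhg _ _ _ _ _).2 ⟨hbase, rfl⟩⟩
  have hRP : ∀ {x t}, V x t → x ∈ RP M P := by
    intro x t h
    obtain ⟨n, r, hn, -⟩ := hV h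
    exact ⟨n, hn ▸ hp r⟩
  let us : X → ℝ := fun x => if h : ∃ t, V x t then h.choose else u x
  have husV : ∀ x ∈ RP M P, V x (us x) := by
    intro x hx
    have h := hex x hx
    simpa only [us, dif_pos h] using h.choose_spec
  have husu : ∀ x ∈ (RP M P)ᶜ, us x = u x := by
    intro x hx
    exact dif_neg fun ⟨t, h⟩ => hx (hRP h)
  refine ⟨us, fun x => ?_, fun r => ?_, ?_, husu⟩
  · by_cases hx : x ∈ RP M P
    · have h := hstep (husV x hx)
      exact huniq (husV _ (hRP h)) h
    · rw [husu x hx, husu (M.T x) fun h => hx (mem_RP_of_map_mem h), hui x hx]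
  · have h : V (p r) (s r) := ⟨0, r, rfl⟩
    exact huniq (husV _ (hRP h)) h
  · obtain ⟨S, hS⟩ := (finite_range fun r => |s r|).bddAbove
    refine ⟨max B (Sk.CS * (S + B) + B), fun x => ?_⟩
    by_cases hx : x ∈ RP M P
    · obtain ⟨n, r, -, h⟩ := hV (husV x hx)
      rw [h]
      refine (Sk.abs_hIter_le hB hui n x (s r)).trans (le_max_of_le_right ?_)
      have hCS : 0 ≤ Sk.CS := zero_le_one.trans Sk.CS_ge_one
      gcongr
      exact hS (mem_range_self r)
    · rw [husu x hx]
      exact (hB x hx).trans (le_max_left _ _)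

end Bony
end
end

section
/- Let T : X → X be a continuous expanding Markov map of the circle with |T'(x)| ≥ θ^{-1} > 1 on partition interiors, let p be a periodic point of T, and let P denote the periodic orbit of p. There exists ε > 0 such that for all δ with 0 < δ ≤ ε: if x ∈ B_δ(p) and the orbit segment x, Tx, …, T^n x is contained in B_δ(P), then d(T^j x, T^j p) < δ θ^{n−j} for all 0 ≤ j ≤ n. -/
open Filter Set Metric Topology MeasureTheory

noncomputable section

namespace Bony

variable {X : Type*} [MetricSpace X] [CompactSpace X]

/-- A finite set is uniformly discrete. -/
theorem exists_pos_dist_lt_imp_eq {Y : Type*} [MetricSpace Y] {P : Set Y} (hP : P.Finite) :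
    ∃ s > (0:ℝ), ∀ a ∈ P, ∀ b ∈ P, dist a b < s → a = b := by
  have h : ∀ᶠ s in 𝓝[>] (0:ℝ), ∀ a ∈ P, ∀ b ∈ P, dist a b < s → a = b := by
    refine hP.eventually_all.2 fun a _ => hP.eventually_all.2 fun b _ => ?_
    by_cases hab : a = b
    · exact Eventually.of_forall fun _ _ => hab
    · filter_upwards [Ioo_mem_nhdsGT (dist_pos.2 hab)] with s hs hlt
      exact absurd hlt hs.2.le.not_gt
  obtain ⟨s, hs, hs0⟩ := (h.and self_mem_nhdsWithin).exists
  exact ⟨s, hs0, hs⟩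

/-- A property which holds near each point of a finite set holds on a uniform neighbourhood. -/
theorem exists_pos_forall_dist_lt {Y : Type*} [MetricSpace Y] {P : Set Y} (hP : P.Finite)
    {Q : Y → Y → Prop} (hQ : ∀ q ∈ P, ∀ᶠ y in 𝓝 q, Q q y) :
    ∃ r > (0:ℝ), ∀ q ∈ P, ∀ y, dist y q < r → Q q y := by
  have h : ∀ᶠ r in 𝓝[>] (0:ℝ), ∀ q ∈ P, ∀ y, dist y q < r → Q q y := by
    refine hP.eventually_all.2 fun q hq => ?_
    obtain ⟨r, hr, hball⟩ := Metric.eventually_nhds_iff.1 (hQ q hq)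
    filter_upwards [Ioo_mem_nhdsGT hr] with s hs y hy
    exact hball (hy.trans hs.2)
  obtain ⟨r, hr, hr0⟩ := (h.and self_mem_nhdsWithin).exists
  exact ⟨r, hr0, hr⟩

/-- Every point has a neighbourhood on which `T` expands the distance to that point. -/
theorem ExpandingMarkov.eventually_dist_le (M : ExpandingMarkov X) (q : X) :
    ∀ᶠ y in 𝓝 q, dist y q ≤ M.θ * dist (M.T y) (M.T q) := by
  have h : ∀ᶠ y in 𝓝 q, ∀ j, y ∈ M.piece j → q ∈ M.piece j := by
    refine eventually_all.2 fun j => ?_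
    by_cases hq : q ∈ M.piece j
    · exact Eventually.of_forall fun _ _ => hq
    · filter_upwards [(M.piece_closed j).isOpen_compl.mem_nhds hq] with y hy hyj
      exact absurd hyj hy
  filter_upwards [h] with y hy
  obtain ⟨j, hj⟩ := mem_iUnion.1 (M.piece_cover.symm ▸ mem_univ y : y ∈ ⋃ j, M.piece j)
  exact M.expand j y hj q (hy j hj)

/-- The orbit of a periodic point is finite. -/
theorem finite_range_iterate {Y : Type*} {T : Y → Y} {p : Y} {m : ℕ} (hm : 0 < m)
    (hper : T^[m] p = p) : (range fun k : ℕ => T^[k] p).Finite := by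
  refine ((Set.finite_Iio m).image fun k => T^[k] p).subset ?_
  rintro _ ⟨k, rfl⟩
  exact ⟨k % m, Nat.mod_lt k hm, Function.IsPeriodicPt.iterate_mod_apply hper k⟩

/-- **Lemma (shadowing estimate).** Let `p` be a periodic point of the expanding Markov
map `T` with orbit `P = {T^k p}`. There is `ε > 0` such that for all `0 < δ ≤ ε`:
if `x ∈ B_δ(p)` and the orbit segment `x, Tx, …, T^n x` stays in `B_δ(P)`, then
`d(T^j x, T^j p) < δ θ^{n-j}` for all `0 ≤ j ≤ n`. -/
theorem shadowing_estimate
    (M : ExpandingMarkov X) (p : X) (m : ℕ) (hm : 0 < m) (hper : M.T^[m] p = p) :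
    ∃ ε > (0:ℝ), ∀ δ : ℝ, 0 < δ → δ ≤ ε →
      ∀ (x : X) (n : ℕ), dist x p < δ →
        (∀ j ≤ n, ∃ k : ℕ, dist (M.T^[j] x) (M.T^[k] p) < δ) →
        ∀ j ≤ n, dist (M.T^[j] x) (M.T^[j] p) < δ * M.θ ^ (n - j) := by
  have hP := finite_range_iterate hm hper
  obtain ⟨s, hs0, hs⟩ := exists_pos_dist_lt_imp_eq hP
  obtain ⟨r, hr0, hr⟩ := exists_pos_forall_dist_lt hP
    (Q := fun q y => dist y q ≤ M.θ * dist (M.T y) (M.T q) ∧ dist (M.T y) (M.T q) < s / 2)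
    fun q _ => (M.eventually_dist_le q).and
      (M.contT.continuousAt.eventually (Metric.ball_mem_nhds _ (half_pos hs0)))
  refine ⟨min r (s / 2), lt_min hr0 (half_pos hs0), fun δ _ hδ x n hx horb => ?_⟩
  have hclose : ∀ j ≤ n, dist (M.T^[j] x) (M.T^[j] p) < δ := by
    intro j
    induction j with
    | zero => exact fun _ => hx
    | succ j ih =>
      intro hj
      obtain ⟨k, hk⟩ := horb (j + 1) hj
      have hnext := (hr _ ⟨j, rfl⟩ _
        ((ih (Nat.le_of_succ_le hj)).trans_le (hδ.trans (min_le_left _ _)))).2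
      simp only [← Function.iterate_succ_apply'] at hnext
      have heq : M.T^[k] p = M.T^[j + 1] p := by
        refine hs _ ⟨k, rfl⟩ _ ⟨j + 1, rfl⟩ ?_
        have htri := dist_triangle_left (M.T^[k] p) (M.T^[j + 1] p) (M.T^[j + 1] x)
        have hδs := hδ.trans (min_le_right _ _)
        linarith
      rwa [heq] at hk
  intro j hj
  induction hj using Nat.decreasingInduction with
  | self => simpa using hclose n le_rfl
  | of_succ j hj ih =>
    have hstep := (hr _ ⟨j, rfl⟩ _
      ((hclose j hj.le).trans_le (hδ.trans (min_le_left _ _)))).1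
    simp only [← Function.iterate_succ_apply'] at hstep
    calc dist (M.T^[j] x) (M.T^[j] p)
        ≤ M.θ * dist (M.T^[j + 1] x) (M.T^[j + 1] p) := hstep
      _ < M.θ * (δ * M.θ ^ (n - (j + 1))) := mul_lt_mul_of_pos_left ih M.θ_pos
      _ = δ * M.θ ^ (n - j) := by
        rw [show n - j = n - (j + 1) + 1 by omega, pow_succ]
        ring

end Bony
end
end

section
/- Let T : X → X be a continuous expanding Markov map of the circle, let 0 < δ ≤ ε < 1 be small enough that the shadowing estimate holds, and let g ∈ C^α_P. Let n ≥ 2. If the orbit segment Tx, …, T^{n−1}x lies in B_δ(P), then |h^n_x(t) − t| ≤ A_h(t), where A_h(t) > 0 depends on t but is independent of n and of x. -/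
open Filter Set Metric Topology MeasureTheory

noncomputable section

namespace Bony

variable {X : Type*} [MetricSpace X] [CompactSpace X]

/-- Cocycle property of the fibre inverses. -/
theorem hIter_add {X : Type*} (T : X → X) (h : X → ℝ → ℝ) (a b : ℕ) (x : X) (t : ℝ) :
    hIter T h (a + b) x t = hIter T h a x (hIter T h b (T^[a] x) t) := by
  induction a generalizing x with
  | zero => simp [hIter]
  | succ a ih =>
    rw [Nat.add_right_comm]
    simp only [hIter, ih, Function.iterate_succ_apply]

theorem hIter_gIter {X : Type*} (T : X → X) {g h : X → ℝ → ℝ} (hg : ∀ x t, h x (g x t) = t)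
    (n : ℕ) (x : X) (t : ℝ) : hIter T h n x (gIter T g n x t) = t := by
  induction n with
  | zero => rfl
  | succ n ih =>
    rw [hIter_add T h n 1]
    simp only [hIter, gIter, hg, ih]

theorem hIter_mod {X : Type*} {T : X → X} {h : X → ℝ → ℝ} {l : ℕ} {q : X}
    (hq : T^[l] q = q) (hid : ∀ t, hIter T h l q t = t) (k : ℕ) (t : ℝ) :
    hIter T h (k % l) q t = hIter T h k q t := by
  have key : ∀ c : ℕ, hIter T h (l * c + k % l) q t = hIter T h (k % l) q t := by
    intro c
    induction c with
    | zero => simp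
    | succ c ih => rw [Nat.mul_succ, Nat.add_comm (l * c), Nat.add_assoc, hIter_add, hq, hid, ih]
  rw [← key (k / l), Nat.div_add_mod]

/-- Fibre inverses are bounded along periodic orbits on which some period acts trivially. -/
theorem exists_abs_hIter_le {X : Type*} {T : X → X} {h : X → ℝ → ℝ} (P : Finset X)
    (hper : ∀ q ∈ P, ∃ l, 0 < l ∧ T^[l] q = q ∧ ∀ t, hIter T h l q t = t) (t : ℝ) :
    ∃ B : ℝ, ∀ q ∈ P, ∀ k, |hIter T h k q t| ≤ B := by
  have hfin : (⋃ q ∈ P, Set.range fun k => |hIter T h k q t|).Finite := by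
    refine P.finite_toSet.biUnion fun q hq => ?_
    obtain ⟨l, hl, hTl, hid⟩ := hper q hq
    refine ((Set.finite_Iio l).image fun k => |hIter T h k q t|).subset ?_
    rintro _ ⟨k, rfl⟩
    exact ⟨k % l, Nat.mod_lt _ hl, by simp only [hIter_mod hTl hid]⟩
  obtain ⟨B, hB⟩ := hfin.bddAbove
  exact ⟨B, fun q hq k => hB (Set.mem_biUnion hq ⟨k, rfl⟩)⟩

/-- Telescoping comparison of the fibre inverses over two orbits. -/
theorem abs_hIter_sub_le_sum {X : Type*} {T : X → X} {h : X → ℝ → ℝ} {L : ℝ} (hL : 0 ≤ L)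
    (hlip : ∀ (n : ℕ) (x : X) (t t' : ℝ), |hIter T h n x t - hIter T h n x t'| ≤ L * |t - t'|)
    (m : ℕ) (y p : X) (t : ℝ) (e : ℕ → ℝ)
    (he : ∀ j < m, |h (T^[j] y) (hIter T h (m - (j + 1)) (T^[j + 1] p) t)
      - h (T^[j] p) (hIter T h (m - (j + 1)) (T^[j + 1] p) t)| ≤ e j) :
    |hIter T h m y t - hIter T h m p t| ≤ L * ∑ j ∈ Finset.range m, e j := by
  have key : ∀ k ≤ m, |hIter T h k y (hIter T h (m - k) (T^[k] p) t) - hIter T h m p t|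
      ≤ L * ∑ j ∈ Finset.range k, e j := by
    intro k
    induction k with
    | zero => simp [hIter]
    | succ k ih =>
      intro hk
      have hsplit : hIter T h (m - k) (T^[k] p) t
          = h (T^[k] p) (hIter T h (m - (k + 1)) (T^[k + 1] p) t) := by
        rw [show m - k = (m - (k + 1)) + 1 by omega]
        simp only [hIter, Function.iterate_succ_apply']
      have h1 := ih (by omega)
      rw [hsplit] at h1
      rw [hIter_add T h k 1, Finset.sum_range_succ, mul_add]
      simp only [hIter]
      have h2 := (hlip k y (h (T^[k] y) (hIter T h (m - (k + 1)) (T^[k + 1] p) t))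
        (h (T^[k] p) (hIter T h (m - (k + 1)) (T^[k + 1] p) t))).trans
        (mul_le_mul_of_nonneg_left (he k (by omega)) hL)
      have h3 := abs_sub_le
        (hIter T h k y (h (T^[k] y) (hIter T h (m - (k + 1)) (T^[k + 1] p) t)))
        (hIter T h k y (h (T^[k] p) (hIter T h (m - (k + 1)) (T^[k + 1] p) t)))
        (hIter T h m p t)
      linarith
  simpa [hIter] using key m le_rfl

/-- **Lemma (boundedness of `h^n_x` along orbits shadowing `P`).** Let `0 < δ ≤ ε < 1`
be small enough that the shadowing estimate holds and let `g ∈ C^α_P`. For `n ≥ 2`,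
if the orbit segment `Tx, …, T^{n-1}x` lies in `B_δ(P)`, then `|h^n_x(t) − t| ≤ A_h(t)`
where `A_h(t) > 0` depends on `t` but not on `n` or `x`. -/
theorem hIter_bounded_on_bad_orbits
    (M : ExpandingMarkov X) (P : Finset X) (hPne : P.Nonempty)
    (CS α : ℝ) (hCS : 1 ≤ CS) (hα : 0 < α)
    (g h : X → ℝ → ℝ) (hmem : InClass M P CS α g h) (hP : ∀ p ∈ P, M.T p ∈ P)
    (δ ε : ℝ) (hδ : 0 < δ) (hδε : δ ≤ ε) (hε : ε < 1)
    (hshadow : ∀ p ∈ P, ∀ (x : X) (n : ℕ), dist x p < δ →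
      (∀ j ≤ n, infDist (M.T^[j] x) (P : Set X) < δ) →
      ∀ j ≤ n, dist (M.T^[j] x) (M.T^[j] p) < δ * M.θ ^ (n - j)) :
    ∃ A : ℝ → ℝ, ∀ t : ℝ, 0 < A t ∧
      ∀ (n : ℕ) (x : X), 2 ≤ n →
        (∀ j, 1 ≤ j → j ≤ n - 1 → infDist (M.T^[j] x) (P : Set X) < δ) →
        |hIter M.T h n x t - t| ≤ A t := by
  obtain ⟨-, -, -, hhg, hper, hlip, -, -, ⟨Ch, hCh0, hCh, hChb⟩, -⟩ := hmem
  have hCS0 : 0 ≤ CS := zero_le_one.trans hCS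
  have hPit : ∀ p ∈ P, ∀ j, M.T^[j] p ∈ P := by
    intro p hp j
    induction j with
    | zero => exact hp
    | succ j ih => rw [Function.iterate_succ_apply']; exact hP _ ih
  have hper' : ∀ q ∈ P, ∃ l, 0 < l ∧ M.T^[l] q = q ∧ ∀ t, hIter M.T h l q t = t := by
    intro q hq
    obtain ⟨l, hl, hid⟩ := hper q hq
    refine ⟨l, hl.1, hl.2.1, fun t => ?_⟩
    simpa only [hid t] using hIter_gIter M.T hhg l q t
  have hr0 : 0 ≤ M.θ ^ α := Real.rpow_nonneg M.θ_pos.le _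
  have hr1 : M.θ ^ α < 1 := Real.rpow_lt_one M.θ_pos.le M.θ_lt_one hα
  suffices H : ∀ t : ℝ, ∃ a : ℝ, 0 < a ∧ ∀ (n : ℕ) (x : X), 2 ≤ n →
      (∀ j, 1 ≤ j → j ≤ n - 1 → infDist (M.T^[j] x) (P : Set X) < δ) →
      |hIter M.T h n x t - t| ≤ a by
    choose A hA using H
    exact ⟨A, hA⟩
  intro t
  obtain ⟨B, hB⟩ := exists_abs_hIter_le P hper' t
  obtain ⟨C, hC⟩ := hChb (Icc (-B) B) isCompact_Icc
  have hCB : ∀ s, |s| ≤ B → Ch s ≤ C := fun s hs => hC ⟨s, abs_le.1 hs, rfl⟩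
  obtain ⟨p₀, hp₀⟩ := hPne
  have hC0 : 0 ≤ C := (hCh0 _).trans (hCB _ (hB p₀ hp₀ 0))
  have horb : ∀ (m : ℕ) (y : X), 1 ≤ m → (∀ j ≤ m - 1, infDist (M.T^[j] y) (P : Set X) < δ) →
      |hIter M.T h m y t| ≤ CS * (C * (1 - M.θ ^ α)⁻¹) + B := by
    intro m y hm hy
    obtain ⟨p, hp, hyp⟩ := (infDist_lt_iff ⟨p₀, hp₀⟩).1 (hy 0 (Nat.zero_le _))
    have hsh := hshadow p hp y (m - 1) hyp hy
    have hdiff := abs_hIter_sub_le_sum hCS0 hlip m y p t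
      (fun j => C * (M.θ ^ α) ^ (m - 1 - j)) (by
        intro j hj
        refine (hCh _ _ _).trans
          (mul_le_mul (hCB _ (hB _ (hPit p hp _) _)) ?_ (Real.rpow_nonneg dist_nonneg _) hC0)
        have hd : dist (M.T^[j] y) (M.T^[j] p) ≤ M.θ ^ (m - 1 - j) :=
          (hsh j (by omega)).le.trans
            (mul_le_of_le_one_left (pow_nonneg M.θ_pos.le _) (hδε.trans hε.le))
        calc dist (M.T^[j] y) (M.T^[j] p) ^ α ≤ (M.θ ^ (m - 1 - j)) ^ α :=
              Real.rpow_le_rpow dist_nonneg hd hα.le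
          _ = (M.θ ^ α) ^ (m - 1 - j) := (Real.rpow_pow_comm M.θ_pos.le _ _).symm)
    have hsum : ∑ j ∈ Finset.range m, C * (M.θ ^ α) ^ (m - 1 - j) ≤ C * (1 - M.θ ^ α)⁻¹ := by
      rw [← Finset.mul_sum, Finset.sum_range_reflect (fun j => (M.θ ^ α) ^ j) m,
        ← tsum_geometric_of_lt_one hr0 hr1]
      exact mul_le_mul_of_nonneg_left ((summable_geometric_of_lt_one hr0 hr1).sum_le_tsum _
        fun i _ => pow_nonneg hr0 i) hC0
    have h1 := hdiff.trans (mul_le_mul_of_nonneg_left hsum hCS0)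
    have h2 := abs_sub_abs_le_abs_sub (hIter M.T h m y t) (hIter M.T h m p t)
    linarith [hB p hp m]
  set R := CS * (C * (1 - M.θ ^ α)⁻¹) + B
  have hR0 : 0 ≤ R := by
    have := (abs_nonneg _).trans (hB p₀ hp₀ 0)
    have := inv_nonneg.2 (sub_nonneg.2 hr1.le)
    positivity
  set D := Ch 0 * diam (univ : Set X) ^ α + |h p₀ 0|
  have hD0 : 0 ≤ D :=
    add_nonneg (mul_nonneg (hCh0 0) (Real.rpow_nonneg diam_nonneg _)) (abs_nonneg _)
  refine ⟨CS * R + D + |t| + 1, by positivity, fun n x hn hx => ?_⟩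
  obtain ⟨m, rfl⟩ : ∃ m, n = m + 1 := ⟨n - 1, by omega⟩
  have hy := horb m (M.T x) (by omega) fun j hj => by
    simpa only [Function.iterate_succ_apply] using hx (j + 1) (by omega) (by omega)
  have h1 : |h x (hIter M.T h m (M.T x) t) - h x 0| ≤ CS * R := by
    have := hlip 1 x (hIter M.T h m (M.T x) t) 0
    simp only [hIter, sub_zero] at this
    exact this.trans (mul_le_mul_of_nonneg_left hy hCS0)
  have h2 : |h x 0 - h p₀ 0| ≤ Ch 0 * diam (univ : Set X) ^ α :=
    (hCh 0 x p₀).trans (mul_le_mul_of_nonneg_left (Real.rpow_le_rpow dist_nonneg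
      (dist_le_diam_of_mem isCompact_univ.isBounded (mem_univ _) (mem_univ _)) hα.le) (hCh0 0))
  simp only [hIter]
  rw [abs_le] at h1 h2 ⊢
  have := neg_abs_le (h p₀ 0)
  have := le_abs_self (h p₀ 0)
  have := neg_abs_le t
  have := le_abs_self t
  constructor <;> linarith [h1.1, h1.2, h2.1, h2.2]

end Bony
end
end
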